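/- arXiv:1805.03361 — 3 statements merged into one kernel-verified Lean document; each statement's English description precedes it below -/
import Mathlib

section
/- Let p be a prime and let f(t) = ∑_{n≥0} a_n tⁿ ∈ ℚ_p[[t]] be a formal power series whose formal derivative f'(t) = ∑_{n≥0} (n+1)a_{n+1} tⁿ has all coefficients in ℤ_p and is not identically zero modulo p. Let m_f be the least integer n ≥ 0 such that (n+1)a_{n+1} is a p-adic unit. If m_f < p − 2, then the set of z ∈ ℚ_p with |z|_p ≤ p^{−1} such that the series ∑_{n≥0} a_n zⁿ converges with sum 0 is finite of cardinality at most m_f + 1. -/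
theorem not_hasSum_zero_of_dominant_term {ι E : Type*} [NormedAddCommGroup E]
    [IsUltrametricDist E] {t : ι → E} {i : ι} (hi : t i ≠ 0)
    (hlt : ∀ j, j ≠ i → ‖t j‖ < ‖t i‖) : ¬ HasSum t 0 := by
  classical
  intro h
  have hpos : 0 < ‖t i‖ := norm_pos_iff.mpr hi
  have hnorm : Filter.Tendsto (fun s : Finset ι => ‖∑ j ∈ s, t j‖) Filter.atTop (nhds 0) := by
    simpa using Filter.Tendsto.norm (show Filter.Tendsto _ _ _ from h)
  obtain ⟨s, hs, his⟩ := ((hnorm.eventually (gt_mem_nhds hpos)).and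
    (Filter.eventually_ge_atTop {i})).exists
  have his : i ∈ s := his (Finset.mem_singleton_self i)
  have herase : ‖∑ j ∈ s.erase i, t j‖ < ‖t i‖ := by
    rcases (s.erase i).eq_empty_or_nonempty with he | hne
    · simpa [he] using hi
    · obtain ⟨j, hj, hle⟩ :=
        IsUltrametricDist.exists_norm_finsetSum_le_of_nonempty hne t
      exact hle.trans_lt (hlt j (Finset.ne_of_mem_erase hj))
  have heq : t i = ∑ j ∈ s, t j - ∑ j ∈ s.erase i, t j := by
    rw [← Finset.add_sum_erase s t his, add_sub_cancel_right]
  refine lt_irrefl ‖t i‖ ?_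
  calc ‖t i‖ = ‖∑ j ∈ s, t j - ∑ j ∈ s.erase i, t j‖ := by rw [← heq]
    _ ≤ max ‖∑ j ∈ s, t j‖ ‖∑ j ∈ s.erase i, t j‖ :=
      by simpa only [sub_eq_add_neg, norm_neg] using
        IsUltrametricDist.norm_add_le_max (∑ j ∈ s, t j) (-∑ j ∈ s.erase i, t j)
    _ < ‖t i‖ := max_lt hs herase

/-- A form of Strassmann's theorem for series `∑ bₙ Pₙ(w)` in integral polynomials: if `P_N` is
monic of degree `d`, the earlier `Pₙ` have smaller degree, and `b_N` strictly dominates all later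
coefficients, then the series has at most `d` zeros in `ℤ_p`. -/
theorem PadicInt.encard_hasSum_eval_zero_le {p : ℕ} [Fact p.Prime] {b : ℕ → ℚ_[p]} {N : ℕ}
    (hN : b N ≠ 0) (hb : ∀ n, N < n → ‖b n‖ < ‖b N‖) (d : ℕ) (P : ℕ → Polynomial ℤ_[p])
    (hmonic : (P N).Monic) (hdeg : (P N).natDegree = d) (hlow : ∀ n < N, (P n).degree < d)
    (T : Set ℤ_[p])
    (hT : ∀ w ∈ T, HasSum (fun n => b n * (((P n).eval w : ℤ_[p]) : ℚ_[p])) 0) :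
    T.encard ≤ d := by
  induction d generalizing P T with
  | zero =>
    suffices T = ∅ by simp [this]
    refine Set.eq_empty_of_forall_notMem fun w hw => ?_
    have h1 : P N = 1 := hmonic.natDegree_eq_zero.mp hdeg
    refine not_hasSum_zero_of_dominant_term (i := N) ?_ (fun n hn => ?_) (hT w hw)
    · simpa [h1] using hN
    · rcases lt_or_gt_of_ne hn with hlt | hgt
      · have h0 : P n = 0 := by simpa using hlow n hlt
        simpa [h0, h1] using hN
      · calc ‖b n * (((P n).eval w : ℤ_[p]) : ℚ_[p])‖
            = ‖b n‖ * ‖(P n).eval w‖ := by rw [norm_mul, PadicInt.norm_def]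
          _ ≤ ‖b n‖ := mul_le_of_le_one_right (norm_nonneg _) (PadicInt.norm_le_one _)
          _ < ‖b N‖ := hb n hgt
          _ = _ := by simp [h1]
  | succ d ih =>
    rcases T.eq_empty_or_nonempty with rfl | ⟨α, hα⟩
    · simp
    have hmon := Polynomial.monic_X_sub_C α
    have key : (T \ {α}).encard ≤ d := by
      refine ih (fun n => P n /ₘ (Polynomial.X - Polynomial.C α)) ?_ ?_ ?_ _ ?_
      · have hd : (P N).degree ≠ 0 := by
          intro h0
          have h0' := Polynomial.natDegree_eq_of_degree_eq_some (n := 0) h0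
          omega
        rw [Polynomial.Monic, Polynomial.leadingCoeff_divByMonic_X_sub_C _ hd]
        exact hmonic
      · rw [Polynomial.natDegree_divByMonic _ hmon, hdeg, Polynomial.natDegree_X_sub_C]
        rfl
      · intro n hn
        rcases eq_or_ne (P n /ₘ (Polynomial.X - Polynomial.C α)) 0 with h0 | h0
        · simp [h0]
        have hle := Polynomial.natDegree_divByMonic (P n) hmon
        have hP : P n ≠ 0 := by
          rintro h
          simp [h] at h0
        have hlt := (Polynomial.natDegree_lt_iff_degree_lt hP).mpr (hlow n hn)
        rw [← Polynomial.natDegree_lt_iff_degree_lt h0, hle, Polynomial.natDegree_X_sub_C]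
        have hge : 0 < (P n).natDegree := by
          by_contra hcon
          apply h0
          rw [Polynomial.divByMonic_eq_zero_iff hmon, Polynomial.degree_X_sub_C]
          refine lt_of_le_of_lt Polynomial.degree_le_natDegree ?_
          rw [Nat.eq_zero_of_not_pos hcon]
          exact zero_lt_one
        omega
      · rintro w ⟨hw, hwα⟩
        have hne : ((w - α : ℤ_[p]) : ℚ_[p]) ≠ 0 := by
          rw [Ne, PadicInt.coe_eq_zero, sub_eq_zero]
          exact hwα
        have hsub := ((hT w hw).sub (hT α hα)).mul_left ((w - α : ℤ_[p]) : ℚ_[p])⁻¹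
        rw [sub_zero, mul_zero] at hsub
        refine hsub.congr_fun ?_
        intro n
        have h := congrArg (Polynomial.eval w)
          (Polynomial.X_sub_C_mul_divByMonic_eq_sub_modByMonic (P n) α)
        rw [Polynomial.modByMonic_X_sub_C_eq_C_eval] at h
        simp only [Polynomial.eval_mul, Polynomial.eval_sub, Polynomial.eval_X,
          Polynomial.eval_C] at h
        rw [← mul_sub, ← PadicInt.coe_sub, ← h, PadicInt.coe_mul]
        field_simp
    rw [← Set.encard_sdiff_singleton_add_one hα]
    push_cast
    gcongr

theorem Nat.add_le_pow_add_one {p v : ℕ} (hp : 2 ≤ p) (hv : 1 ≤ v) : p + v ≤ p ^ v + 1 := by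
  induction v, hv using Nat.le_induction with
  | base => simp
  | succ v hv ih =>
    have : 1 ≤ p ^ v := Nat.one_le_pow _ _ (by omega)
    rw [pow_succ]
    nlinarith

theorem Padic.norm_mul_pow_lt_of_norm_natCast_mul_le {p : ℕ} [hp : Fact p.Prime] {x : ℚ_[p]}
    {k n : ℕ} (hk : k + 1 < p) (hkn : k < n) (hx : ‖(n : ℚ_[p]) * x‖ ≤ 1) :
    ‖x * (p : ℚ_[p]) ^ n‖ < ((p : ℝ)⁻¹) ^ k := by
  have hp1 : (1 : ℝ) < p := by exact_mod_cast hp.out.one_lt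
  have hp0 : (0 : ℝ) < p := by linarith
  have hn : (n : ℚ_[p]) ≠ 0 := by
    exact_mod_cast (show n ≠ 0 by omega)
  set v := padicValNat p n with hv
  have hexp : v + k < n := by
    rcases Nat.eq_zero_or_pos v with h0 | h0
    · omega
    · have h1 := Nat.add_le_pow_add_one hp.out.two_le h0
      have h2 : p ^ v ≤ n := Nat.le_of_dvd (by omega) pow_padicValNat_dvd
      omega
  have hnorm : ‖(n : ℚ_[p])‖ = ((p : ℝ) ^ v)⁻¹ := by
    rw [Padic.norm_eq_zpow_neg_valuation hn, Padic.valuation_natCast, zpow_neg, zpow_natCast]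
  rw [norm_mul, hnorm, inv_mul_le_iff₀ (by positivity), mul_one] at hx
  rw [norm_mul, norm_pow, Padic.norm_p]
  calc ‖x‖ * (p : ℝ)⁻¹ ^ n ≤ (p : ℝ) ^ v * (p : ℝ)⁻¹ ^ n := by gcongr
    _ < (p : ℝ) ^ v * (p : ℝ)⁻¹ ^ (v + k) := by
      gcongr ?_ * ?_
      exact pow_lt_pow_right_of_lt_one₀ (by positivity) (inv_lt_one_of_one_lt₀ hp1) hexp
    _ = (p : ℝ)⁻¹ ^ k := by
      rw [pow_add, ← mul_assoc, ← mul_pow, mul_inv_cancel₀ hp0.ne', one_pow, one_mul]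


/-- Let `p` be a prime and `f(t) = ∑ aₙ tⁿ ∈ ℚ_p[[t]]` a formal power series
whose formal derivative `f'(t) = ∑ (n+1)a_{n+1} tⁿ` has all coefficients in `ℤ_p` and is not
identically zero mod `p`; let `m` be the least `n` with `(n+1)a_{n+1}` a `p`-adic unit.
If `m < p - 2`, then the set of `z ∈ ℚ_p` with `|z|_p ≤ p⁻¹` where the series converges to `0`
is finite of cardinality at most `m + 1`. -/
theorem stmt0 (p : ℕ) [hp : Fact p.Prime] (a : ℕ → ℚ_[p])
    (hint : ∀ n : ℕ, ‖((n + 1 : ℕ) : ℚ_[p]) * a (n + 1)‖ ≤ 1)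
    (m : ℕ)
    (hm : ‖((m + 1 : ℕ) : ℚ_[p]) * a (m + 1)‖ = 1)
    (hmin : ∀ n < m, ‖((n + 1 : ℕ) : ℚ_[p]) * a (n + 1)‖ < 1)
    (hmp : m + 2 < p) :
    ({z : ℚ_[p] | ‖z‖ ≤ (p : ℝ)⁻¹ ∧ HasSum (fun n => a n * z ^ n) 0}).Finite ∧
      ({z : ℚ_[p] | ‖z‖ ≤ (p : ℝ)⁻¹ ∧ HasSum (fun n => a n * z ^ n) 0}).ncard ≤ m + 1 := by
  have hp0 : (p : ℚ_[p]) ≠ 0 := by exact_mod_cast hp.out.ne_zero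
  have hunit : ‖((m + 1 : ℕ) : ℚ_[p])‖ = 1 := by
    rw [Padic.norm_natCast_eq_one_iff]
    exact Nat.coprime_of_lt_prime (by omega) (by omega) hp.out
  have ha : ‖a (m + 1)‖ = 1 := by rwa [norm_mul, hunit, one_mul] at hm
  have hbN : ‖a (m + 1) * (p : ℚ_[p]) ^ (m + 1)‖ = (p : ℝ)⁻¹ ^ (m + 1) := by
    rw [norm_mul, ha, one_mul, norm_pow, Padic.norm_p]
  let T : Set ℤ_[p] :=
    {w | HasSum (fun n => a n * (p : ℚ_[p]) ^ n * (w : ℚ_[p]) ^ n) 0}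
  have hT : T.encard ≤ (m + 1 : ℕ) := by
    refine PadicInt.encard_hasSum_eval_zero_le (N := m + 1)
      (b := fun n => a n * (p : ℚ_[p]) ^ n) ?_ ?_ (m + 1) (fun n => Polynomial.X ^ n)
      (Polynomial.monic_X_pow _) (Polynomial.natDegree_X_pow _) ?_ T fun w hw => ?_
    · exact mul_ne_zero (norm_ne_zero_iff.mp (by simp [ha])) (pow_ne_zero _ hp0)
    · intro n hn
      rw [hbN]
      refine Padic.norm_mul_pow_lt_of_norm_natCast_mul_le hmp hn ?_
      simpa [Nat.sub_add_cancel (show 1 ≤ n by omega)] using hint (n - 1)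
    · intro n hn
      rw [Polynomial.degree_X_pow]
      exact_mod_cast hn
    · have hw : HasSum (fun n => a n * (p : ℚ_[p]) ^ n * (w : ℚ_[p]) ^ n) 0 := hw
      simpa only [Polynomial.eval_pow, Polynomial.eval_X, PadicInt.coe_pow] using hw
  have hsub : {z : ℚ_[p] | ‖z‖ ≤ (p : ℝ)⁻¹ ∧ HasSum (fun n => a n * z ^ n) 0} ⊆
      (fun w : ℤ_[p] => (p : ℚ_[p]) * w) '' T := by
    rintro z ⟨hz, hsum⟩
    have hw : ‖z / p‖ ≤ 1 := by
      have hpR : (0 : ℝ) < p := by exact_mod_cast hp.out.pos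
      rw [norm_div, Padic.norm_p]
      exact div_le_one_of_le₀ hz (by positivity)
    refine ⟨⟨z / p, hw⟩, ?_, mul_div_cancel₀ z hp0⟩
    change HasSum (fun n => a n * (p : ℚ_[p]) ^ n * (z / p) ^ n) 0
    refine hsum.congr_fun fun n => ?_
    rw [mul_assoc, ← mul_pow, mul_div_cancel₀ z hp0]
  have hcard := (Set.encard_le_encard hsub).trans ((Set.encard_image_le _ T).trans hT)
  have hfin := Set.finite_of_encard_le_coe hcard
  refine ⟨hfin, ?_⟩
  rw [← hfin.cast_ncard_eq] at hcard
  exact_mod_cast hcard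
end

section
/- Let p be a prime and let N be an integer with 1 ≤ N ≤ p^p − p. Let A be the least multiple of p with A ≥ N, and let e = v_p(A) ≥ 1. Define M = A + 1 if A − e < N, and M = N otherwise. Then every integer i ≥ M satisfies i − v_p(i) ≥ N. -/
/-- The function `v ↦ p ^ v - v` is monotone from `p` on. -/
theorem pow_self_add_le_pow_add {p v : ℕ} (hp : 2 ≤ p) (hv : p ≤ v) :
    p ^ p + v ≤ p ^ v + p := by
  induction v, hv using Nat.le_induction with
  | base => rfl
  | succ v _ ih =>
    have h1 : 1 ≤ p ^ v := Nat.one_le_pow _ _ (by lia)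
    have h2 : p ^ v * 2 ≤ p ^ v * p := Nat.mul_le_mul_left _ hp
    rw [pow_succ]
    lia

/-- Let `p` be prime, `1 ≤ N ≤ p^p - p`, `A` the least multiple of `p` with
`A ≥ N` (i.e. `p ∣ A`, `N ≤ A < N + p`) and `e = v_p(A)`. With `M = A + 1` if `A - e < N`
and `M = N` otherwise, every integer `i ≥ M` satisfies `i - v_p(i) ≥ N`. -/
theorem stmt3 (p : ℕ) (hp : p.Prime) (N A : ℕ) (hN1 : 1 ≤ N) (hN2 : N ≤ p ^ p - p)
    (hAdvd : p ∣ A) (hAge : N ≤ A) (hAlt : A < N + p) :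
    ∀ i : ℕ, (if A - padicValNat p A < N then A + 1 else N) ≤ i →
      N ≤ i - padicValNat p i := by
  intro i hi
  have hNi : N ≤ i := by split_ifs at hi <;> lia
  by_cases hdvd : p ∣ i
  · obtain rfl | hne := eq_or_ne i A
    · split_ifs at hi <;> lia
    · have hAi : A + p ≤ i := by
        obtain ⟨a, rfl⟩ := hAdvd
        obtain ⟨b, rfl⟩ := hdvd
        have hab : a < b := by
          by_contra! hba
          have hlt : b + 1 ≤ a := lt_of_le_of_ne hba fun h => hne (by rw [h])
          have := Nat.mul_le_mul_left p hlt
          lia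
        exact Nat.mul_le_mul_left p hab
      obtain hv | hv := le_total (padicValNat p i) p
      · lia
      · have hpow : p ^ padicValNat p i ≤ i := Nat.le_of_dvd (by lia) pow_padicValNat_dvd
        have := pow_self_add_le_pow_add hp.two_le hv
        lia
  · rw [padicValNat.eq_zero_of_not_dvd hdvd]
    exact hNi
end

section
/- Let p be a prime and let N be an integer with 1 ≤ N ≤ p^p − p. Let A be the least multiple of p with A ≥ N and e = v_p(A); define M = A + 1 if A − e < N, and M = N otherwise. Then for every a ∈ ℤ_p and every integer i ≥ M, one has |a · pⁱ / i|_p ≤ p^{−N}. -/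
/-- If `N ≤ p ^ p - p`, then every `i` strictly above a multiple `A ≥ N` of `p` satisfies
`i - v_p(i) ≥ N`. -/
lemma add_padicValNat_le_of_lt {p N A i : ℕ} [hp : Fact p.Prime] (hN : N ≤ p ^ p - p)
    (hdvd : p ∣ A) (hNA : N ≤ A) (hAi : A < i) : N + padicValNat p i ≤ i := by
  have hi0 : i ≠ 0 := by lia
  by_cases hpi : p ∣ i
  · rcases le_total (padicValNat p i) p with hv | hv
    · have : p ≤ i - A := Nat.le_of_dvd (by lia) (Nat.dvd_sub hpi hdvd)
      lia
    · obtain ⟨k, hk⟩ := Nat.exists_eq_add_of_le hv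
      have hle : p ^ padicValNat p i ≤ i := Nat.le_of_dvd (by lia) pow_padicValNat_dvd
      have h1 : k + 1 ≤ p ^ k := Nat.lt_pow_self hp.out.one_lt
      have h2 : 1 ≤ p ^ p := Nat.one_le_pow _ _ hp.out.pos
      have h3 : p ≤ p ^ p := (Nat.lt_pow_self hp.out.one_lt).le
      rw [hk, pow_add] at hle
      rw [hk]
      have : p ^ p + k ≤ p ^ p * p ^ k := by nlinarith
      lia
  · rw [padicValNat.eq_zero_of_not_dvd hpi]
    lia

/-- If `i - v_p(i) ≥ N`, then `a * p ^ i / i` has norm at most `p ^ (-N)` for `p`-integral `a`. -/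
lemma norm_padicInt_mul_pow_div_le {p N i : ℕ} [hp : Fact p.Prime] (a : ℤ_[p]) (hi : i ≠ 0)
    (h : N + padicValNat p i ≤ i) :
    ‖(a : ℚ_[p]) * (p : ℚ_[p]) ^ i / (i : ℚ_[p])‖ ≤ (p : ℝ) ^ (-(N : ℤ)) := by
  have hp0 : (p : ℝ) ≠ 0 := by exact_mod_cast hp.out.ne_zero
  have hp1 : (1 : ℝ) ≤ p := by exact_mod_cast hp.out.one_le
  have hnorm : ‖(i : ℚ_[p])‖ = (p : ℝ) ^ (-(padicValNat p i : ℤ)) := by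
    rw [Padic.norm_eq_zpow_neg_valuation (by exact_mod_cast hi), Padic.valuation_natCast]
  rw [mul_div_assoc, norm_mul, norm_div, Padic.norm_p_pow, hnorm, ← zpow_sub₀ hp0]
  calc ‖(a : ℚ_[p])‖ * (p : ℝ) ^ (-(i : ℤ) - -(padicValNat p i : ℤ))
      ≤ 1 * (p : ℝ) ^ (-(i : ℤ) - -(padicValNat p i : ℤ)) := by
        gcongr
        exact a.2
    _ ≤ (p : ℝ) ^ (-(N : ℤ)) := by
        rw [one_mul]
        exact zpow_le_zpow_right₀ hp1 (by lia)


/-- Let `p` be prime, `1 ≤ N ≤ p^p - p`, `A` the least multiple of `p` with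
`A ≥ N` (i.e. `p ∣ A`, `N ≤ A < N + p`) and `e = v_p(A)`; set `M = A + 1` if `A - e < N`
and `M = N` otherwise. Then for every `a ∈ ℤ_p` and every integer `i ≥ M`,
`|a · pⁱ / i|_p ≤ p^{-N}`. -/
theorem stmt4 (p : ℕ) [hp : Fact p.Prime] (N A : ℕ) (hN1 : 1 ≤ N) (hN2 : N ≤ p ^ p - p)
    (hAdvd : p ∣ A) (hAge : N ≤ A) (hAlt : A < N + p) :
    ∀ (a : ℤ_[p]) (i : ℕ), (if A - padicValNat p A < N then A + 1 else N) ≤ i →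
      ‖(a : ℚ_[p]) * (p : ℚ_[p]) ^ i / (i : ℚ_[p])‖ ≤ (p : ℝ) ^ (-(N : ℤ)) := by
  intro a i hi
  have hNi : N ≤ i := by split_ifs at hi <;> lia
  refine norm_padicInt_mul_pow_div_le a (by lia) ?_
  rcases lt_trichotomy i A with hlt | rfl | hgt
  · have hpi : ¬ p ∣ i := fun hpi => by
      have : p ≤ A - i := Nat.le_of_dvd (by lia) (Nat.dvd_sub hAdvd hpi)
      lia
    rw [padicValNat.eq_zero_of_not_dvd hpi]
    lia
  · split_ifs at hi <;> lia
  · exact add_padicValNat_le_of_lt hN2 hAdvd hAge hgt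
end
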